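/- arXiv:2204.13460 — 5 statements merged into one kernel-verified Lean document; each statement's English description precedes it below -/
import Mathlib

section
/- Let F(w,l) = (l⁻¹(Cw − (wᵀCw)w) + ½(wᵀw − 1)w, wᵀCw − l·wᵀw) denote the right-hand side of the nPCA system, and let q ∈ {1,…,n} with λ_q ≠ 0. Then the Jacobian (total derivative) of F at the point (v_q, λ_q) equals the block matrix [[λ_q⁻¹·C − v_q v_qᵀ − I_n, 0],[0ᵀ, −1]]. -/
open Matrix

/-- The right-hand side of the nPCA system
`ẇ = l⁻¹(Cw − (wᵀCw)w) + ½(wᵀw − 1)w`, `l̇ = wᵀCw − l·wᵀw`. -/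
noncomputable def nPCA {n : ℕ} (C : Matrix (Fin n) (Fin n) ℝ)
    (x : (Fin n → ℝ) × ℝ) : (Fin n → ℝ) × ℝ :=
  (x.2⁻¹ • (C *ᵥ x.1 - (x.1 ⬝ᵥ C *ᵥ x.1) • x.1) + ((x.1 ⬝ᵥ x.1 - 1) / 2) • x.1,
   x.1 ⬝ᵥ C *ᵥ x.1 - x.2 * (x.1 ⬝ᵥ x.1))

/-- Product rule for the dot product of two vector-valued maps. -/
theorem HasFDerivAt.dotProduct {E ι : Type*} [NormedAddCommGroup E] [NormedSpace ℝ E] [Fintype ι]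
    {f g : E → ι → ℝ} {f' g' : E →L[ℝ] (ι → ℝ)} {x : E}
    (hf : HasFDerivAt f f' x) (hg : HasFDerivAt g g' x) :
    HasFDerivAt (fun y => f y ⬝ᵥ g y)
      (∑ i, (f x i • (ContinuousLinearMap.proj i ∘L g') +
        g x i • (ContinuousLinearMap.proj i ∘L f'))) x :=
  HasFDerivAt.fun_sum fun i _ => (hasFDerivAt_pi'.1 hf i).mul (hasFDerivAt_pi'.1 hg i)

/-- The matrix-vector product with a differentiable vector-valued map is differentiable. -/
theorem HasFDerivAt.matrix_mulVec {E ι κ : Type*} [NormedAddCommGroup E] [NormedSpace ℝ E]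
    [Fintype ι] [Fintype κ] (A : Matrix κ ι ℝ) {f : E → ι → ℝ} {f' : E →L[ℝ] (ι → ℝ)} {x : E}
    (hf : HasFDerivAt f f' x) :
    HasFDerivAt (fun y => A *ᵥ f y) (A.mulVecLin.toContinuousLinearMap ∘L f') x :=
  A.mulVecLin.toContinuousLinearMap.hasFDerivAt.comp x hf

/-- The Jacobian (total derivative) of the nPCA right-hand side
at the fixed point `(v_q, λ_q)` is the block matrix
`[[λ_q⁻¹ C − v_q v_qᵀ − I_n, 0], [0ᵀ, −1]]`, acting as
`(μ, ν) ↦ ((λ_q⁻¹ C − v_q v_qᵀ − I_n) μ, −ν)`. -/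
theorem nPCA_jacobian_at_eigenpair
    (n : ℕ) (hn : 4 ≤ n)
    (C : Matrix (Fin n) (Fin n) ℝ) (hC : C.IsSymm)
    (v : Fin n → (Fin n → ℝ)) (lam : Fin n → ℝ)
    (horth : ∀ i j, v i ⬝ᵥ v j = if i = j then (1 : ℝ) else 0)
    (heig : ∀ k, C *ᵥ v k = lam k • v k)
    (hdec : StrictAnti lam)
    (q : Fin n) (hq : lam q ≠ 0) :
    ∃ L : ((Fin n → ℝ) × ℝ) →L[ℝ] ((Fin n → ℝ) × ℝ),
      HasFDerivAt (nPCA C) L (v q, lam q) ∧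
      ∀ (μ : Fin n → ℝ) (ν : ℝ),
        L (μ, ν) =
          (((lam q)⁻¹ • C - Matrix.vecMulVec (v q) (v q)
              - (1 : Matrix (Fin n) (Fin n) ℝ)) *ᵥ μ, -ν) := by
  have hvv : v q ⬝ᵥ v q = 1 := by simp [horth]
  have hsymm (μ : Fin n → ℝ) : v q ⬝ᵥ C *ᵥ μ = lam q * (v q ⬝ᵥ μ) := by
    rw [dotProduct_mulVec, ← mulVec_transpose, hC.eq, heig, smul_dotProduct, smul_eq_mul]
  have hw : HasFDerivAt (fun x : (Fin n → ℝ) × ℝ => x.1)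
      (ContinuousLinearMap.fst ℝ (Fin n → ℝ) ℝ) (v q, lam q) := hasFDerivAt_fst
  have hl : HasFDerivAt (fun x : (Fin n → ℝ) × ℝ => x.2)
      (ContinuousLinearMap.snd ℝ (Fin n → ℝ) ℝ) (v q, lam q) := hasFDerivAt_snd
  have hCw := hw.matrix_mulVec C
  have hquad := hw.dotProduct hCw
  have hnorm := hw.dotProduct hw
  have hinv := (hasDerivAt_inv hq).comp_hasFDerivAt (v q, lam q) hl
  have hfst := (hinv.smul (hCw.sub (hquad.smul hw))).add
    (((hnorm.sub_const 1).mul_const 2⁻¹).smul hw)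
  have hsnd := hquad.sub (hl.mul hnorm)
  refine ⟨_, hfst.prodMk hsnd, fun μ ν => ?_⟩
  have hsum (a b : Fin n → ℝ) : ∑ i, a i * b i = a ⬝ᵥ b := rfl
  have hscaled : (fun i => lam q * v q i) ⬝ᵥ μ = lam q * (v q ⬝ᵥ μ) :=
    smul_dotProduct (lam q) (v q) μ
  ext i
  · simp [heig, hvv, hsum, Finset.sum_add_distrib, sub_mulVec, smul_mulVec,
      vecMulVec_mulVec, hsymm, hscaled]
    field_simp
    ring
  · simp [heig, hvv, hsum, Finset.sum_add_distrib, hsymm, hscaled]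
end

section
/- Let q ∈ {1,…,n} with λ_q ≠ 0. The (n+1)×(n+1) matrix J̄ = [[λ_q⁻¹·C − v_q v_qᵀ − I_n, 0],[0ᵀ, −1]] (the Jacobian of the nPCA system at the equilibrium (v_q, λ_q)) has exactly the eigenvalues λ_q⁻¹·λ_k − 1 for each k ∈ {1,…,n} with k ≠ q, together with the eigenvalue −1 with multiplicity two (arising from the index q and the last diagonal position). -/
open Matrix Polynomial

/-- A square matrix with a full family of eigenvectors that is orthonormal for the dot product
has the product of the linear factors of its eigenvalues as characteristic
polynomial. -/
theorem charpoly_eq_prod_of_orthonormal_eigenvectors {ι R : Type*} [Fintype ι] [DecidableEq ι]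
    [CommRing R] (M : Matrix ι ι R) (v : ι → ι → R) (μ : ι → R)
    (horth : ∀ i j, v i ⬝ᵥ v j = if i = j then (1 : R) else 0)
    (heig : ∀ k, M *ᵥ v k = μ k • v k) :
    M.charpoly = ∏ k, (X - Polynomial.C (μ k)) := by
  let V : Matrix ι ι R := Matrix.of v
  have hV : V * Vᵀ = 1 := by
    ext i j
    simpa [Matrix.mul_apply, V, dotProduct, Matrix.one_apply] using horth i j
  have hV' : Vᵀ * V = 1 := mul_eq_one_comm.mp hV
  have hMV : M * Vᵀ = Vᵀ * diagonal μ := by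
    ext i k
    have h := congrFun (heig k) i
    simp only [mulVec, dotProduct, Pi.smul_apply, smul_eq_mul] at h
    rw [Matrix.mul_diagonal]
    simp [Matrix.mul_apply, V, h, mul_comm]
  have hM : M = Vᵀ * (diagonal μ * V) := by
    rw [← Matrix.mul_assoc, ← hMV, Matrix.mul_assoc, hV', Matrix.mul_one]
  rw [hM, Matrix.charpoly_mul_comm, Matrix.mul_assoc, hV, Matrix.mul_one,
    Matrix.charpoly_diagonal]

/-- The Jacobian `J̄ = [[λ_q⁻¹ C − v_q v_qᵀ − I_n, 0], [0ᵀ, −1]]`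
of the nPCA system at the equilibrium `(v_q, λ_q)` has exactly the eigenvalues
`λ_q⁻¹ λ_k − 1` for `k ≠ q` together with `−1` of multiplicity two, i.e. its
characteristic polynomial is `(X + 1)² ∏_{k ≠ q} (X − (λ_q⁻¹ λ_k − 1))`. -/
theorem nPCA_jacobian_eigenvalues
    (n : ℕ) (hn : 4 ≤ n)
    (C : Matrix (Fin n) (Fin n) ℝ) (hC : C.IsSymm)
    (v : Fin n → (Fin n → ℝ)) (lam : Fin n → ℝ)
    (horth : ∀ i j, v i ⬝ᵥ v j = if i = j then (1 : ℝ) else 0)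
    (heig : ∀ k, C *ᵥ v k = lam k • v k)
    (hdec : StrictAnti lam)
    (q : Fin n) (hq : lam q ≠ 0) :
    Matrix.charpoly
        (Matrix.fromBlocks
          ((lam q)⁻¹ • C - Matrix.vecMulVec (v q) (v q)
            - (1 : Matrix (Fin n) (Fin n) ℝ))
          (0 : Matrix (Fin n) Unit ℝ)
          (0 : Matrix Unit (Fin n) ℝ)
          (-1 : Matrix Unit Unit ℝ))
      = (X + Polynomial.C 1) ^ 2 *
          ∏ k ∈ Finset.univ.filter (fun k : Fin n => k ≠ q),
            (X - Polynomial.C ((lam q)⁻¹ * lam k - 1)) := by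
  have hblock := charpoly_eq_prod_of_orthonormal_eigenvectors
    ((lam q)⁻¹ • C - Matrix.vecMulVec (v q) (v q) - (1 : Matrix (Fin n) (Fin n) ℝ)) v
    (fun k => if k = q then -1 else (lam q)⁻¹ * lam k - 1) horth (by
      intro k
      ext i
      by_cases hk : k = q
      · subst hk
        simp [sub_mulVec, smul_mulVec, vecMulVec_mulVec, heig, horth, hq]
      · simp [sub_mulVec, smul_mulVec, vecMulVec_mulVec, heig, horth, hk, Ne.symm hk]
        ring)
  have hcorner : (-1 : Matrix Unit Unit ℝ).charpoly = X + Polynomial.C 1 := by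
    simp [Matrix.charpoly]
  rw [Matrix.charpoly_fromBlocks_zero₁₂, hblock, hcorner,
    ← Finset.mul_prod_erase _ _ (Finset.mem_univ q), Finset.filter_ne',
    Finset.prod_congr rfl (fun k hk => by rw [if_neg (Finset.ne_of_mem_erase hk)])]
  simp only [if_true, map_neg, sub_neg_eq_add]
  ring
end

section
/- Assume all eigenvalues λ_1 > … > λ_n are positive. For q ∈ {1,…,n}, all eigenvalues of the Jacobian of the nPCA system at the equilibrium (v_q, λ_q) are strictly negative if and only if q = 1. Moreover, for every q > 1 this Jacobian has at least one strictly positive eigenvalue (namely λ_q⁻¹λ_1 − 1), so every non-principal equilibrium is a saddle point. -/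
open Matrix

theorem Matrix.mem_spectrum_iff_exists_mulVec_eq_smul {K ι : Type*} [Field K] [Fintype ι]
    [DecidableEq ι] {M : Matrix ι ι K} {a : K} :
    a ∈ spectrum K M ↔ ∃ w : ι → K, w ≠ 0 ∧ M *ᵥ w = a • w := by
  rw [← Matrix.spectrum_toLin', ← Module.End.hasEigenvalue_iff_mem_spectrum]
  constructor
  · intro h
    obtain ⟨w, hw⟩ := h.exists_hasEigenvector
    exact ⟨w, hw.2, by simpa using hw.apply_eq_smul⟩
  · rintro ⟨w, hw, h⟩
    exact Module.End.hasEigenvalue_of_hasEigenvector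
      (Module.End.hasEigenvector_iff.mpr ⟨Module.End.mem_eigenspace_iff.mpr (by simpa using h), hw⟩)

theorem Matrix.mem_spectrum_fromBlocks_zero_zero_iff {K ι κ : Type*} [Field K] [Fintype ι]
    [DecidableEq ι] [Fintype κ] [DecidableEq κ] {A : Matrix ι ι K} {D : Matrix κ κ K} {a : K} :
    a ∈ spectrum K (Matrix.fromBlocks A 0 0 D) ↔ a ∈ spectrum K A ∨ a ∈ spectrum K D := by
  have h : algebraMap K (Matrix (ι ⊕ κ) (ι ⊕ κ) K) a - Matrix.fromBlocks A 0 0 D =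
      Matrix.fromBlocks (algebraMap K (Matrix ι ι K) a - A) 0 0
        (algebraMap K (Matrix κ κ K) a - D) := by
    ext (i | i) (j | j) <;> simp [Matrix.algebraMap_matrix_apply]
  rw [spectrum.mem_iff, spectrum.mem_iff, spectrum.mem_iff, h,
    Matrix.isUnit_fromBlocks_zero₂₁, not_and_or]

theorem eq_zero_of_forall_dotProduct_orthonormal {ι : Type*} [Fintype ι] [DecidableEq ι]
    {v : ι → ι → ℝ} (horth : ∀ i j, v i ⬝ᵥ v j = if i = j then (1 : ℝ) else 0)
    {w : ι → ℝ} (hw : ∀ k, v k ⬝ᵥ w = 0) : w = 0 := by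
  have h : Matrix.of v * (Matrix.of v)ᵀ = 1 := by
    ext i j
    rw [Matrix.one_apply, ← horth i j]
    rfl
  have hvw : Matrix.of v *ᵥ w = 0 := funext hw
  rw [← Matrix.one_mulVec w, ← mul_eq_one_comm.mp h, ← Matrix.mulVec_mulVec, hvw,
    Matrix.mulVec_zero]

theorem Matrix.IsSymm.mem_spectrum_iff_of_orthonormal {ι : Type*} [Fintype ι] [DecidableEq ι]
    {A : Matrix ι ι ℝ} (hA : A.IsSymm) {v : ι → ι → ℝ} {μ : ι → ℝ}
    (horth : ∀ i j, v i ⬝ᵥ v j = if i = j then (1 : ℝ) else 0)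
    (heig : ∀ k, A *ᵥ v k = μ k • v k) {a : ℝ} :
    a ∈ spectrum ℝ A ↔ ∃ k, a = μ k := by
  rw [Matrix.mem_spectrum_iff_exists_mulVec_eq_smul]
  constructor
  · rintro ⟨w, hw, haw⟩
    obtain ⟨k, hk⟩ : ∃ k, v k ⬝ᵥ w ≠ 0 := by
      by_contra! h
      exact hw (eq_zero_of_forall_dotProduct_orthonormal horth h)
    have h : v k ⬝ᵥ A *ᵥ w = μ k * (v k ⬝ᵥ w) := by
      rw [Matrix.dotProduct_mulVec, ← Matrix.mulVec_transpose, hA.eq, heig, smul_dotProduct,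
        smul_eq_mul]
    rw [haw, dotProduct_smul, smul_eq_mul] at h
    exact ⟨k, mul_right_cancel₀ hk h⟩
  · rintro ⟨k, rfl⟩
    refine ⟨v k, fun h => ?_, heig k⟩
    simpa [h] using horth k k

theorem mem_spectrum_nPCA_jacobian_iff {ι : Type*} [Fintype ι] [DecidableEq ι]
    {C : Matrix ι ι ℝ} (hC : C.IsSymm) {v : ι → ι → ℝ} {lam : ι → ℝ}
    (horth : ∀ i j, v i ⬝ᵥ v j = if i = j then (1 : ℝ) else 0)
    (heig : ∀ k, C *ᵥ v k = lam k • v k) (q : ι) {a : ℝ} :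
    a ∈ spectrum ℝ
        (Matrix.fromBlocks
          ((lam q)⁻¹ • C - Matrix.vecMulVec (v q) (v q) - (1 : Matrix ι ι ℝ))
          (0 : Matrix ι Unit ℝ) (0 : Matrix Unit ι ℝ) (-1 : Matrix Unit Unit ℝ)) ↔
      (∃ k, a = (lam q)⁻¹ * lam k - (if q = k then 1 else 0) - 1) ∨ a = -1 := by
  have hA : ((lam q)⁻¹ • C - Matrix.vecMulVec (v q) (v q) - (1 : Matrix ι ι ℝ)).IsSymm := by
    simp [Matrix.IsSymm, Matrix.transpose_sub, Matrix.transpose_smul, hC.eq,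
      Matrix.transpose_vecMulVec]
  have hAv (k : ι) : ((lam q)⁻¹ • C - Matrix.vecMulVec (v q) (v q) - (1 : Matrix ι ι ℝ)) *ᵥ v k =
      ((lam q)⁻¹ * lam k - (if q = k then 1 else 0) - 1) • v k := by
    rw [Matrix.sub_mulVec, Matrix.sub_mulVec, Matrix.smul_mulVec, Matrix.one_mulVec, heig,
      Matrix.vecMulVec_mulVec, horth]
    split_ifs with h
    · subst h
      simp [sub_smul, mul_smul]
    · simp [sub_smul, mul_smul]
  have hD : a ∈ spectrum ℝ (-1 : Matrix Unit Unit ℝ) ↔ a = -1 := by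
    have h : (-1 : Matrix Unit Unit ℝ) = algebraMap ℝ _ (-1) := by simp
    rw [h, spectrum.scalar_eq, Set.mem_singleton_iff]
  rw [Matrix.mem_spectrum_fromBlocks_zero_zero_iff,
    hA.mem_spectrum_iff_of_orthonormal horth hAv, hD]

/-- Assume all eigenvalues are positive. For `q`, the Jacobian
`[[λ_q⁻¹ C − v_q v_qᵀ − I_n, 0], [0ᵀ, −1]]` of the nPCA system at `(v_q, λ_q)`
has only strictly negative eigenvalues iff `q = 1` (the principal index);
moreover for `q > 1` the strictly positive number `λ_q⁻¹ λ_1 − 1` is an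
eigenvalue, so every non-principal equilibrium is a saddle point. -/
theorem nPCA_stability_principal
    (n : ℕ) (hn : 4 ≤ n)
    (C : Matrix (Fin n) (Fin n) ℝ) (hC : C.IsSymm)
    (v : Fin n → (Fin n → ℝ)) (lam : Fin n → ℝ)
    (horth : ∀ i j, v i ⬝ᵥ v j = if i = j then (1 : ℝ) else 0)
    (heig : ∀ k, C *ᵥ v k = lam k • v k)
    (hdec : StrictAnti lam) (hpos : ∀ k, 0 < lam k)
    (q : Fin n) (i₁ : Fin n) (hi₁ : (i₁ : ℕ) = 0) :
    ((∀ α ∈ spectrum ℝ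
        (Matrix.fromBlocks
          ((lam q)⁻¹ • C - Matrix.vecMulVec (v q) (v q)
            - (1 : Matrix (Fin n) (Fin n) ℝ))
          (0 : Matrix (Fin n) Unit ℝ) (0 : Matrix Unit (Fin n) ℝ)
          (-1 : Matrix Unit Unit ℝ)), α < 0) ↔ q = i₁) ∧
    (q ≠ i₁ →
      ((lam q)⁻¹ * lam i₁ - 1) ∈ spectrum ℝ
        (Matrix.fromBlocks
          ((lam q)⁻¹ • C - Matrix.vecMulVec (v q) (v q)
            - (1 : Matrix (Fin n) (Fin n) ℝ))
          (0 : Matrix (Fin n) Unit ℝ) (0 : Matrix Unit (Fin n) ℝ)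
          (-1 : Matrix Unit Unit ℝ)) ∧
      0 < (lam q)⁻¹ * lam i₁ - 1) := by
  simp only [mem_spectrum_nPCA_jacobian_iff hC horth heig q]
  have hgrow (hq : q ≠ i₁) : 0 < (lam q)⁻¹ * lam i₁ - 1 := by
    have hlt : i₁ < q := by
      rw [Fin.lt_def]
      have : (q : ℕ) ≠ i₁ := fun h => hq (Fin.ext h)
      omega
    rw [sub_pos, inv_mul_eq_div, one_lt_div (hpos q)]
    exact hdec hlt
  refine ⟨⟨fun h => ?_, ?_⟩, fun hq => ⟨Or.inl ⟨i₁, by simp [hq]⟩, hgrow hq⟩⟩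
  · by_contra hq
    exact (hgrow hq).not_gt (h _ (Or.inl ⟨i₁, by simp [hq]⟩))
  · rintro rfl a (⟨k, rfl⟩ | rfl)
    · have hle : (lam q)⁻¹ * lam k ≤ 1 := by
        rw [inv_mul_eq_div, div_le_one (hpos q)]
        exact hdec.antitone (Fin.le_def.mpr (by omega))
      split_ifs with hk
      · linarith
      · have hlt : (lam q)⁻¹ * lam k < 1 := by
          rw [inv_mul_eq_div, div_lt_one (hpos q)]
          refine hdec (lt_of_le_of_ne (Fin.le_def.mpr (by omega)) hk)
        linarith
    · norm_num
end

section
/- Fix 3 ≤ p ≤ n − 1 with λ_p ≠ 0 and λ_p ≠ λ_i for i < p. Let F(w,l) denote the right-hand side of the arbitrary-eigenpair system ẇ = l⁻¹(Cw − (wᵀCw)w) + ½(wᵀw − 1)w − (Σ_{i=1}^{p−1} [(λ_i − l)⁻¹ + l⁻¹]·v_i v_iᵀ)(Cw − l·w), l̇ = wᵀCw − l·wᵀw. Then the Jacobian of F at the equilibrium (v_p, λ_p), conjugated by the orthogonal matrix T = [[V,0],[0ᵀ,1]], is the diagonal matrix with entries −1 at positions 1,…,p and at position n+1, and entries λ_p⁻¹·λ_k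 − 1 at positions k = p+1,…,n. -/
open Matrix

/-- The right-hand side of the coupled learning rule for the `p`-th eigenpair
(`0`-based index `p`). -/
noncomputable def arbSys {n : ℕ} (C : Matrix (Fin n) (Fin n) ℝ)
    (v : Fin n → (Fin n → ℝ)) (lam : Fin n → ℝ) (p : Fin n)
    (x : (Fin n → ℝ) × ℝ) : (Fin n → ℝ) × ℝ :=
  (x.2⁻¹ • (C *ᵥ x.1 - (x.1 ⬝ᵥ C *ᵥ x.1) • x.1) + ((x.1 ⬝ᵥ x.1 - 1) / 2) • x.1
      - (∑ i ∈ Finset.univ.filter (fun i : Fin n => i < p),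
          ((lam i - x.2)⁻¹ + x.2⁻¹) • Matrix.vecMulVec (v i) (v i)) *ᵥ
        (C *ᵥ x.1 - x.2 • x.1),
   x.1 ⬝ᵥ C *ᵥ x.1 - x.2 * (x.1 ⬝ᵥ x.1))

/-- The `(n+1) × (n+1)` matrix of a continuous linear map on `ℝⁿ × ℝ` with
respect to the standard basis. -/
noncomputable def clmMatrix {n : ℕ}
    (L : ((Fin n → ℝ) × ℝ) →L[ℝ] ((Fin n → ℝ) × ℝ)) :
    Matrix (Fin n ⊕ Unit) (Fin n ⊕ Unit) ℝ :=
  Matrix.of fun i j =>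
    Sum.elim
      (fun i' => (L (Sum.elim (fun j' => (Pi.single j' (1 : ℝ), (0 : ℝ)))
        (fun _ => (0, 1)) j)).1 i')
      (fun _ => (L (Sum.elim (fun j' => (Pi.single j' (1 : ℝ), (0 : ℝ)))
        (fun _ => (0, 1)) j)).2) i

lemma clmMatrix_mulVec {n : ℕ} (L : ((Fin n → ℝ) × ℝ) →L[ℝ] ((Fin n → ℝ) × ℝ))
    (w : Fin n → ℝ) (l : ℝ) :
    clmMatrix L *ᵥ Sum.elim w (fun _ => l) =
      Sum.elim (L (w, l)).1 (fun _ => (L (w, l)).2) := by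
  have hdecomp : ((w, l) : (Fin n → ℝ) × ℝ) =
      ∑ j, w j • ((Pi.single j (1 : ℝ), 0) : (Fin n → ℝ) × ℝ) + l • (0, 1) := by
    ext i
    · simp [Prod.fst_sum, Finset.sum_apply, Pi.single_apply]
    · simp [Prod.snd_sum]
  have hL := congrArg L hdecomp
  simp only [map_add, map_sum, map_smul] at hL
  rw [hL]
  ext i
  rcases i with i | i
  · simp [Matrix.mulVec, dotProduct, clmMatrix, Prod.fst_sum, Finset.sum_apply, mul_comm]
  · simp [Matrix.mulVec, dotProduct, clmMatrix, Prod.snd_sum, mul_comm]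

lemma sum_smul_vecMulVec_mulVec {n : ℕ} (v : Fin n → (Fin n → ℝ)) (s : Finset (Fin n))
    (c : Fin n → ℝ) (u : Fin n → ℝ) :
    (∑ i ∈ s, c i • Matrix.vecMulVec (v i) (v i)) *ᵥ u =
      ∑ i ∈ s, (c i * (v i ⬝ᵥ u)) • v i := by
  rw [Matrix.sum_mulVec]
  refine Finset.sum_congr rfl fun i _ => ?_
  rw [Matrix.smul_mulVec, Matrix.vecMulVec_mulVec]
  ext j
  simp
  ring

lemma sum_smul_vecMulVec_mulVec_self {n : ℕ} {v : Fin n → (Fin n → ℝ)}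
    (horth : ∀ i j, v i ⬝ᵥ v j = if i = j then (1 : ℝ) else 0)
    (s : Finset (Fin n)) (c : Fin n → ℝ) (k : Fin n) :
    (∑ i ∈ s, c i • Matrix.vecMulVec (v i) (v i)) *ᵥ v k =
      (if k ∈ s then c k else 0) • v k := by
  rw [sum_smul_vecMulVec_mulVec]
  simp [horth, ite_smul]

lemma differentiableAt_arbSys {n : ℕ} (C : Matrix (Fin n) (Fin n) ℝ)
    (v : Fin n → (Fin n → ℝ)) (lam : Fin n → ℝ) (p : Fin n)
    {x : (Fin n → ℝ) × ℝ} (hx : x.2 ≠ 0) (hlam : ∀ i < p, lam i - x.2 ≠ 0) :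
    DifferentiableAt ℝ (arbSys C v lam p) x := by
  unfold arbSys
  simp only [sum_smul_vecMulVec_mulVec]
  have hdot : ∀ {f g : (Fin n → ℝ) × ℝ → (Fin n → ℝ)}, DifferentiableAt ℝ f x →
      DifferentiableAt ℝ g x → DifferentiableAt ℝ (fun y => f y ⬝ᵥ g y) x := by
    intro f g hf hg
    unfold dotProduct
    fun_prop
  have hC : DifferentiableAt ℝ (fun y : (Fin n → ℝ) × ℝ => C *ᵥ y.1) x :=
    differentiableAt_pi.2 fun i => hdot (differentiableAt_const _) differentiableAt_fst
  have hquad := hdot differentiableAt_fst hC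
  have hnorm := hdot (differentiableAt_fst (p := x)) differentiableAt_fst
  have hsum : DifferentiableAt ℝ (fun y : (Fin n → ℝ) × ℝ =>
      ∑ i ∈ Finset.univ.filter (fun i : Fin n => i < p),
        (((lam i - y.2)⁻¹ + y.2⁻¹) * (v i ⬝ᵥ (C *ᵥ y.1 - y.2 • y.1))) • v i) x := by
    refine DifferentiableAt.fun_sum fun i hi => ?_
    have hi' := hlam i (Finset.mem_filter.1 hi).2
    have hres : DifferentiableAt ℝ (fun y : (Fin n → ℝ) × ℝ =>
        v i ⬝ᵥ (C *ᵥ y.1 - y.2 • y.1)) x :=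
      hdot (differentiableAt_const _) (by fun_prop)
    fun_prop (disch := assumption)
  fun_prop (disch := assumption)

lemma fderiv_apply_of_hasDerivAt_line {E F : Type*} [NormedAddCommGroup E] [NormedSpace ℝ E]
    [NormedAddCommGroup F] [NormedSpace ℝ F] {f : E → F} {x d : E} {y : F}
    (hf : DifferentiableAt ℝ f x) (hy : HasDerivAt (fun t : ℝ => f (x + t • d)) y 0) :
    fderiv ℝ f x d = y :=
  (hf.hasFDerivAt.hasLineDerivAt d).unique hy

lemma arbSys_add_smul_snd {n : ℕ} {C : Matrix (Fin n) (Fin n) ℝ}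
    {v : Fin n → (Fin n → ℝ)} {lam : Fin n → ℝ}
    (horth : ∀ i j, v i ⬝ᵥ v j = if i = j then (1 : ℝ) else 0)
    (heig : ∀ k, C *ᵥ v k = lam k • v k) (p : Fin n) (t : ℝ) :
    arbSys C v lam p ((v p, lam p) + t • ((0 : Fin n → ℝ), (1 : ℝ))) = t • (0, -1) := by
  have hres : lam p • v p - (lam p + t) • v p = (-t) • v p := by
    module
  simp [arbSys, heig, hres, Matrix.mulVec_neg, Matrix.mulVec_smul,
    sum_smul_vecMulVec_mulVec_self horth, horth]

lemma arbSys_add_smul_fst {n : ℕ} {C : Matrix (Fin n) (Fin n) ℝ}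
    {v : Fin n → (Fin n → ℝ)} {lam : Fin n → ℝ}
    (horth : ∀ i j, v i ⬝ᵥ v j = if i = j then (1 : ℝ) else 0)
    (heig : ∀ k, C *ᵥ v k = lam k • v k) (p k : Fin n) (t : ℝ) :
    arbSys C v lam p ((v p, lam p) + t • (v k, (0 : ℝ))) =
      ((lam p)⁻¹ • (lam p • v p + (t * lam k) • v k -
          (lam p + 2 * t * lam p * (if p = k then 1 else 0) + t ^ 2 * lam k) • (v p + t • v k))
        + ((2 * t * (if p = k then 1 else 0) + t ^ 2) / 2) • (v p + t • v k)
        - (t * (lam k - lam p) * (if k < p then (lam k - lam p)⁻¹ + (lam p)⁻¹ else 0)) • v k,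
       t ^ 2 * (lam k - lam p)) := by
  have hC : C *ᵥ (v p + t • v k) = lam p • v p + (t * lam k) • v k := by
    rw [Matrix.mulVec_add, Matrix.mulVec_smul, heig, heig]
    module
  have hres : lam p • v p + (t * lam k) • v k - lam p • (v p + t • v k) =
      (t * (lam k - lam p)) • v k := by
    module
  have hquad : (v p + t • v k) ⬝ᵥ (lam p • v p + (t * lam k) • v k) =
      lam p + 2 * t * lam p * (if p = k then 1 else 0) + t ^ 2 * lam k := by
    simp only [add_dotProduct, dotProduct_add, smul_dotProduct, dotProduct_smul, horth,
      smul_eq_mul, if_true, eq_comm (a := k)]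
    split_ifs with h
    · subst h
      ring
    · ring
  have hnorm : (v p + t • v k) ⬝ᵥ (v p + t • v k) =
      1 + 2 * t * (if p = k then 1 else 0) + t ^ 2 := by
    simp only [add_dotProduct, dotProduct_add, smul_dotProduct, dotProduct_smul, horth,
      smul_eq_mul, if_true, eq_comm (a := k)]
    ring
  have hx : ((v p, lam p) + t • (v k, (0 : ℝ)) : (Fin n → ℝ) × ℝ) = (v p + t • v k, lam p) := by
    simp
  rw [hx]
  unfold arbSys
  simp only [hC, hres, hquad, hnorm, Matrix.mulVec_smul, sum_smul_vecMulVec_mulVec_self horth,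
    smul_smul, Finset.mem_filter, Finset.mem_univ, true_and]
  refine Prod.ext ?_ ?_
  · simp only
    congr 3
    ring
  · simp only
    ring

lemma hasDerivAt_arbSys_line_fst {n : ℕ} {C : Matrix (Fin n) (Fin n) ℝ}
    {v : Fin n → (Fin n → ℝ)} {lam : Fin n → ℝ}
    (horth : ∀ i j, v i ⬝ᵥ v j = if i = j then (1 : ℝ) else 0)
    (heig : ∀ k, C *ᵥ v k = lam k • v k) (hinj : Function.Injective lam)
    (p k : Fin n) (hp0 : lam p ≠ 0) :
    HasDerivAt (fun t : ℝ => arbSys C v lam p ((v p, lam p) + t • (v k, (0 : ℝ))))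
      ((if k ≤ p then (-1 : ℝ) else (lam p)⁻¹ * lam k - 1) • v k, 0) 0 := by
  simp only [arbSys_add_smul_fst horth heig]
  refine HasDerivAt.prodMk (hasDerivAt_pi.2 fun i => ?_) ?_
  · have hid := hasDerivAt_id (0 : ℝ)
    set e : ℝ := if p = k then 1 else 0 with he
    set c : ℝ := if k < p then (lam k - lam p)⁻¹ + (lam p)⁻¹ else 0 with hc
    have hw : HasDerivAt (fun t : ℝ => v p i + t * v k i) (v k i) 0 := by
      simpa using (hid.mul_const (v k i)).const_add (v p i)
    have hsq : HasDerivAt (fun t : ℝ => t ^ 2) 0 0 := by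
      simpa using hasDerivAt_pow 2 (0 : ℝ)
    have hlin : ∀ a : ℝ, HasDerivAt (fun t : ℝ => t * a) a 0 := fun a => by
      simpa using hid.mul_const a
    have hq := ((hlin (2 * lam p * e)).const_add (lam p)).add (hsq.mul_const (lam k))
    have hm := ((hlin (2 * e)).add hsq).div_const 2
    have key := (((((hlin (lam k * v k i)).const_add (lam p * v p i)).sub (hq.mul hw)).const_mul
      (lam p)⁻¹).add (hm.mul hw)).sub (hlin ((lam k - lam p) * c * v k i))
    refine (key.congr_deriv ?_).congr_of_eventuallyEq (.of_forall fun t => ?_)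
    · simp only [Pi.add_apply, Pi.smul_apply, smul_eq_mul]
      rcases lt_trichotomy k p with h | h | h
      · have hne : lam k - lam p ≠ 0 := sub_ne_zero.2 (hinj.ne h.ne)
        simp only [he, hc, h, h.le, h.ne', if_true, if_false]
        field_simp
        ring
      · subst h
        simp only [he, hc, lt_irrefl, le_refl, if_true, if_false]
        field_simp
        ring
      · simp only [he, hc, h.not_gt, h.not_ge, h.ne, if_false]
        field_simp
        ring
    · simp only [Pi.add_apply, Pi.sub_apply, Pi.mul_apply, Pi.smul_apply, smul_eq_mul]
      ring
  · simpa using (hasDerivAt_pow 2 (0 : ℝ)).mul_const (lam k - lam p)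

lemma transpose_mul_mul_eq_diagonal {m : Type*} [Fintype m] [DecidableEq m]
    {T A : Matrix m m ℝ} {d : m → ℝ} (hT : Tᵀ * T = 1)
    (hA : ∀ j, A *ᵥ T.col j = d j • T.col j) : Tᵀ * A * T = Matrix.diagonal d := by
  have hAT : A * T = T * Matrix.diagonal d := by
    ext i j
    rw [Matrix.mul_diagonal, mul_comm]
    exact congrFun (hA j) i
  rw [Matrix.mul_assoc, hAT, ← Matrix.mul_assoc, hT, Matrix.one_mul]

/-- The Jacobian of the arbitrary-eigenpair system at the
desired equilibrium `(v_p, λ_p)`, conjugated by `T = [[V, 0], [0ᵀ, 1]]`, is the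
diagonal matrix with entries `−1` at the first `p` positions (`0`-based `k ≤ p`)
and at the last position, and `λ_p⁻¹ λ_k − 1` at positions `k > p`. -/
theorem arbitrary_eigenpair_jacobian_at_p
    (n : ℕ) (hn : 4 ≤ n)
    (C : Matrix (Fin n) (Fin n) ℝ) (hC : C.IsSymm)
    (v : Fin n → (Fin n → ℝ)) (lam : Fin n → ℝ)
    (horth : ∀ i j, v i ⬝ᵥ v j = if i = j then (1 : ℝ) else 0)
    (heig : ∀ k, C *ᵥ v k = lam k • v k)
    (hdec : StrictAnti lam)
    (p : Fin n) (hp2 : 2 ≤ (p : ℕ)) (hpn : (p : ℕ) ≤ n - 2)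
    (hp0 : lam p ≠ 0) (hpi : ∀ i : Fin n, i < p → lam p ≠ lam i) :
    ∃ L : ((Fin n → ℝ) × ℝ) →L[ℝ] ((Fin n → ℝ) × ℝ),
      HasFDerivAt (arbSys C v lam p) L (v p, lam p) ∧
      (Matrix.fromBlocks (Matrix.of fun i j => v j i)
          (0 : Matrix (Fin n) Unit ℝ) (0 : Matrix Unit (Fin n) ℝ)
          (1 : Matrix Unit Unit ℝ))ᵀ * clmMatrix L *
        (Matrix.fromBlocks (Matrix.of fun i j => v j i)
          (0 : Matrix (Fin n) Unit ℝ) (0 : Matrix Unit (Fin n) ℝ)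
          (1 : Matrix Unit Unit ℝ))
        = Matrix.diagonal
            (Sum.elim
              (fun k : Fin n => if k ≤ p then (-1 : ℝ) else (lam p)⁻¹ * lam k - 1)
              (fun _ => (-1 : ℝ))) := by
  have hdiff : DifferentiableAt ℝ (arbSys C v lam p) (v p, lam p) :=
    differentiableAt_arbSys C v lam p hp0 fun i hi => sub_ne_zero.2 (hpi i hi).symm
  refine ⟨_, hdiff.hasFDerivAt, transpose_mul_mul_eq_diagonal ?_ ?_⟩
  · have hV : (Matrix.of fun i j => v j i)ᵀ * (Matrix.of fun i j => v j i) =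
        (1 : Matrix (Fin n) (Fin n) ℝ) := by
      ext i j
      rw [Matrix.one_apply]
      exact horth i j
    simp [Matrix.fromBlocks_transpose, Matrix.fromBlocks_multiply, hV]
  · rintro (k | k)
    · have hcol : (Matrix.fromBlocks (Matrix.of fun i j => v j i)
          (0 : Matrix (Fin n) Unit ℝ) (0 : Matrix Unit (Fin n) ℝ)
          (1 : Matrix Unit Unit ℝ)).col (Sum.inl k) = Sum.elim (v k) (fun _ => 0) := by
        ext (i | i) <;> simp
      rw [hcol, clmMatrix_mulVec, fderiv_apply_of_hasDerivAt_line hdiff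
        (hasDerivAt_arbSys_line_fst horth heig hdec.injective p k hp0)]
      ext (i | i)
      · rfl
      · simp
    · have hcol : (Matrix.fromBlocks (Matrix.of fun i j => v j i)
          (0 : Matrix (Fin n) Unit ℝ) (0 : Matrix Unit (Fin n) ℝ)
          (1 : Matrix Unit Unit ℝ)).col (Sum.inr k) = Sum.elim (0 : Fin n → ℝ) (fun _ => 1) := by
        ext (i | i) <;> simp
      have hline : HasDerivAt (fun t : ℝ => arbSys C v lam p
          ((v p, lam p) + t • ((0 : Fin n → ℝ), (1 : ℝ)))) (0, -1) 0 := by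
        simp only [arbSys_add_smul_snd horth heig]
        simpa using (hasDerivAt_id (0 : ℝ)).smul_const ((0 : Fin n → ℝ), (-1 : ℝ))
      rw [hcol, clmMatrix_mulVec, fderiv_apply_of_hasDerivAt_line hdiff hline]
      ext (i | i) <;> simp
end

section
/- Fix 3 ≤ p ≤ n − 1, q ∈ {1,…,p−1}, and assume λ_1 > … > λ_n > 0. Consider the perturbation expression E(μ, ν) = −Σ_{i=1}^{p−1} (v_iᵀμ)² + Σ_{i=p}^{n} (λ_q⁻¹·λ_i − 1)·(v_iᵀμ)² − ν² − μᵀv_q. Then for μ = −ε·v_q with ε ∈ (0,1), E(μ, ν) = −ε² + ε − ν², and this is strictly positive whenever ν² < ε − ε². In particular there exist arbitrarily small perturbations (μ, ν) ≠ (0,0) with E(μ, ν) > 0, so the equilibria (v_q, λ_q) with q < p are not attracting (they are saddle points). -/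
open Matrix

/-- The first-order perturbation expression
`E(μ, ν) = −Σ_{i<p} (v_iᵀμ)² + Σ_{i≥p} (λ_q⁻¹ λ_i − 1)(v_iᵀμ)² − ν² − μᵀv_q`
arising in the stability analysis of the equilibrium `(v_q, λ_q)` with `q < p`
(`0`-based indices). -/
noncomputable def EPert {n : ℕ} (v : Fin n → (Fin n → ℝ)) (lam : Fin n → ℝ)
    (p q : Fin n) (μ : Fin n → ℝ) (ν : ℝ) : ℝ :=
  -(∑ i ∈ Finset.univ.filter (fun i : Fin n => i < p), (v i ⬝ᵥ μ) ^ 2)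
    + (∑ i ∈ Finset.univ.filter (fun i : Fin n => p ≤ i),
        ((lam q)⁻¹ * lam i - 1) * (v i ⬝ᵥ μ) ^ 2)
    - ν ^ 2 - μ ⬝ᵥ v q

/-- A real vector of Euclidean length one has sup norm at most one. -/
theorem norm_le_one_of_dotProduct_self_eq_one {ι : Type*} [Fintype ι] {w : ι → ℝ}
    (hw : w ⬝ᵥ w = 1) : ‖w‖ ≤ 1 := by
  refine (pi_norm_le_iff_of_nonneg zero_le_one).2 fun i => ?_
  rw [Real.norm_eq_abs, ← sq_le_one_iff_abs_le_one, sq, ← hw]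
  exact Finset.single_le_sum (f := fun j => w j * w j)
    (fun j _ => mul_self_nonneg (w j)) (Finset.mem_univ i)

/-- The value of `EPert` along the direction `-v q`. -/
theorem EPert_neg_smul {n : ℕ} {v : Fin n → (Fin n → ℝ)} (lam : Fin n → ℝ)
    (horth : ∀ i j, v i ⬝ᵥ v j = if i = j then (1 : ℝ) else 0)
    {p q : Fin n} (hq : q < p) (ε ν : ℝ) :
    EPert v lam p q (-(ε • v q)) ν = -ε ^ 2 + ε - ν ^ 2 := by
  have hdot : ∀ i, (v i ⬝ᵥ -(ε • v q)) ^ 2 = if i = q then ε ^ 2 else 0 := by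
    intro i
    rw [dotProduct_neg, dotProduct_smul, horth]
    split_ifs <;> simp
  have hself : -(ε • v q) ⬝ᵥ v q = -ε := by
    rw [neg_dotProduct, smul_dotProduct, horth]
    simp
  simp only [EPert, hdot, hself, mul_ite, mul_zero, Finset.sum_ite_eq', Finset.mem_filter,
    Finset.mem_univ, true_and, hq, not_le.2 hq, if_true, if_false]
  ring

/-- For `q < p` and `μ = −ε v_q` with `ε ∈ (0,1)` we have
`E(μ, ν) = −ε² + ε − ν²`, which is strictly positive whenever `ν² < ε − ε²`;
in particular there exist arbitrarily small nonzero perturbations `(μ, ν)` with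
`E(μ, ν) > 0`, so the equilibria `(v_q, λ_q)` with `q < p` are not attracting. -/
theorem perturbation_saddle_preceding
    (n : ℕ) (hn : 4 ≤ n)
    (C : Matrix (Fin n) (Fin n) ℝ) (hC : C.IsSymm)
    (v : Fin n → (Fin n → ℝ)) (lam : Fin n → ℝ)
    (horth : ∀ i j, v i ⬝ᵥ v j = if i = j then (1 : ℝ) else 0)
    (heig : ∀ k, C *ᵥ v k = lam k • v k)
    (hdec : StrictAnti lam) (hpos : ∀ k, 0 < lam k)
    (p : Fin n) (hp2 : 2 ≤ (p : ℕ)) (hpn : (p : ℕ) ≤ n - 2)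
    (q : Fin n) (hq : q < p) :
    (∀ (ε : ℝ) (ν : ℝ), 0 < ε → ε < 1 →
      EPert v lam p q (-(ε • v q)) ν = -ε ^ 2 + ε - ν ^ 2) ∧
    (∀ (ε : ℝ) (ν : ℝ), 0 < ε → ε < 1 → ν ^ 2 < ε - ε ^ 2 →
      0 < EPert v lam p q (-(ε • v q)) ν) ∧
    (∀ δ : ℝ, 0 < δ → ∃ (μ : Fin n → ℝ) (ν : ℝ),
      (μ, ν) ≠ ((0 : Fin n → ℝ), (0 : ℝ)) ∧ ‖μ‖ < δ ∧ |ν| < δ ∧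
      0 < EPert v lam p q μ ν) := by
  have hpos_val : ∀ ε ν : ℝ, ν ^ 2 < ε - ε ^ 2 → 0 < EPert v lam p q (-(ε • v q)) ν := by
    intro ε ν h
    rw [EPert_neg_smul lam horth hq]
    linarith
  refine ⟨fun ε ν _ _ => EPert_neg_smul lam horth hq ε ν, fun ε ν _ _ => hpos_val ε ν, ?_⟩
  intro δ hδ
  have hvq : v q ⬝ᵥ v q = 1 := by simp [horth]
  obtain ⟨ε, hε, hεmin⟩ := exists_between (lt_min hδ one_pos)
  obtain ⟨hεδ, hε1⟩ := lt_min_iff.1 hεmin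
  refine ⟨-(ε • v q), 0, ?_, ?_, by simpa using hδ, hpos_val ε 0 (by nlinarith)⟩
  · intro h
    have hμ : -(ε • v q) = 0 := congrArg Prod.fst h
    rcases smul_eq_zero.1 (neg_eq_zero.1 hμ) with h0 | h0
    · exact hε.ne' h0
    · simp [h0] at hvq
  · rw [norm_neg, norm_smul, Real.norm_of_nonneg hε.le]
    exact (mul_le_of_le_one_right hε.le
      (norm_le_one_of_dotProduct_self_eq_one hvq)).trans_lt hεδ
end
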